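/- There exist constants C̃₁, C̃₂ > 0 and thresholds α₀, r₀ ∈ (0,1], all depending only on κ and ν, with the following property. Consider a single-arc packet routing with deterministic queuing with a single commodity (|J| = 1), with transit time τ > 0, capacity ν > 0, constant κ ≥ ν + 1, and discretization parameters 0 < α ≤ α₀ and 0 < β ≤ r₀·α, together with an associated hypothetical flow over time h⁻. Let m := β·(total number of packets). Then for every particle φ ∈ (0, m]: | inf{θ ≥ 0 : H⁻(θ) ≥ φ} − ℓ^D_v(⌈φ/β⌉) | ≤ C̃₁·√α + φ·C̃₂·√α, where ℓ^D_v(i) := inf{θ ≥ 0 : G⁻(θ) ≥ iβ} is the refined departure time of packet i. (The claim in the proof of Lemma 5.4.) -/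

import Mathlib

open MeasureTheory Finset

/-- The buffer `B(t)`: packets that entered at a step `≤ t − τ̂` (i.e. `ent i + τ̂ ≤ t`)
and have not left at a step `< t`. -/
def buffer {n : ℕ} (ent lv : Fin n → ℕ) (τh t : ℕ) : Finset (Fin n) :=
  Finset.univ.filter (fun i => ent i + τh ≤ t ∧ t ≤ lv i)

/-- **Single-arc packet routing with deterministic queuing** for an arc with transit
time `τ`, capacity `ν`, inflow bound `κ` and discretization parameters `α` (time-step
length) and `β` (packet volume); `τ̂ = ⌈τ/α⌉` and `ν̂ = να/β`. The `n` packets are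
indexed by `Fin n` in FIFO order, each with a commodity `com i` and an entrance step
`entStep i ≥ 1` (monotone in the FIFO order); the total volume entering at any single
step is at most `ακ`. The current capacity `cap` satisfies `cap 1 = ν̂` and the
carry-over recursion, and at each step `t` exactly the first
`min(|B(t)|, ⌊cap t⌋)` packets of the buffer `B(t)` leave the arc. -/
structure PacketRouting (J : Type) [DecidableEq J] (τ ν κ α β : ℝ) where
  n : ℕ
  com : Fin n → J
  entStep : Fin n → ℕ
  entPos : ∀ i, 1 ≤ entStep i
  entMono : Monotone entStep
  volBound : ∀ t : ℕ,
    β * (((Finset.univ : Finset (Fin n)).filter (fun i => entStep i = t)).card : ℝ)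
      ≤ α * κ
  leaveStep : Fin n → ℕ
  leaveGe : ∀ i, entStep i + ⌈τ / α⌉₊ ≤ leaveStep i
  cap : ℕ → ℝ
  cap1 : cap 1 = ν * α / β
  capRec : ∀ t : ℕ, 1 ≤ t → cap (t + 1) =
    if ((buffer entStep leaveStep ⌈τ / α⌉₊ t).card : ℝ) ≤ cap t
    then ν * α / β
    else ν * α / β + cap t - (⌊cap t⌋ : ℝ)
  leaveSpec : ∀ t : ℕ, 1 ≤ t → ∀ i ∈ buffer entStep leaveStep ⌈τ / α⌉₊ t,
    (leaveStep i = t ↔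
      (((buffer entStep leaveStep ⌈τ / α⌉₊ t).filter (fun i' => i' < i)).card : ℤ)
        < min ((buffer entStep leaveStep ⌈τ / α⌉₊ t).card : ℤ) ⌊cap t⌋)

/-- The step function of value `(β/α)·cnt t` on each time interval `((t−1)α, tα]`
(and `0` on `(−∞, 0]`). -/
noncomputable def stepFun (α β : ℝ) (cnt : ℕ → ℕ) : ℝ → ℝ :=
  fun θ => if 0 < θ then β / α * (cnt ⌈θ / α⌉₊ : ℝ) else 0

/-- The cumulative function `θ ↦ ∫₀^θ` of a step function with per-step counts `cnt`. -/
noncomputable def cumStep (α β : ℝ) (cnt : ℕ → ℕ) (θ : ℝ) : ℝ :=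
  ∫ ξ in (0:ℝ)..θ, stepFun α β cnt ξ

variable {J : Type} [DecidableEq J] {τ ν κ α β : ℝ}

/-- Number of packets of commodity `j` entering the arc at step `t`. -/
def entCount (R : PacketRouting J τ ν κ α β) (j : J) (t : ℕ) : ℕ :=
  ((Finset.univ : Finset (Fin R.n)).filter
    (fun i => R.entStep i = t ∧ R.com i = j)).card

/-- Number of packets of commodity `j` leaving the arc at step `t`. -/
def lvCount (R : PacketRouting J τ ν κ α β) (j : J) (t : ℕ) : ℕ :=
  ((Finset.univ : Finset (Fin R.n)).filter
    (fun i => R.leaveStep i = t ∧ R.com i = j)).card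

/-- Total number of packets entering the arc at step `t`. -/
def entCountTot (R : PacketRouting J τ ν κ α β) (t : ℕ) : ℕ :=
  ((Finset.univ : Finset (Fin R.n)).filter (fun i => R.entStep i = t)).card

/-- Total number of packets leaving the arc at step `t`. -/
def lvCountTot (R : PacketRouting J τ ν κ α β) (t : ℕ) : ℕ :=
  ((Finset.univ : Finset (Fin R.n)).filter (fun i => R.leaveStep i = t)).card

/-- Cumulative inflow `G⁺_j` of commodity `j`. -/
noncomputable def Ginj (R : PacketRouting J τ ν κ α β) (j : J) : ℝ → ℝ :=
  cumStep α β (entCount R j)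

/-- Cumulative outflow `G⁻_j` of commodity `j`. -/
noncomputable def Goutj (R : PacketRouting J τ ν κ α β) (j : J) : ℝ → ℝ :=
  cumStep α β (lvCount R j)

/-- Total cumulative inflow `G⁺`. -/
noncomputable def Gin (R : PacketRouting J τ ν κ α β) : ℝ → ℝ :=
  cumStep α β (entCountTot R)

/-- Total cumulative outflow `G⁻`. -/
noncomputable def Gout (R : PacketRouting J τ ν κ α β) : ℝ → ℝ :=
  cumStep α β (lvCountTot R)

/-- The cumulative function `F(θ) = ∫₀^θ f(ξ) dξ` of a rate function `f`. -/
noncomputable def cumul (f : ℝ → ℝ) (θ : ℝ) : ℝ := ∫ ξ in (0:ℝ)..θ, f ξ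

/-- A Vickrey queue flow for an arc with transit time `τ` and capacity `ν`: a pair
`(fi, fo)` of nonnegative, bounded, locally integrable inflow/outflow rates vanishing on
`(−∞, 0)`, whose queue size `z(θ) = F⁺(θ − τ) − F⁻(θ)` is nonnegative, and such that for
almost every `θ`: `fo θ = ν` if `z θ > 0`, and `fo θ = min (fi (θ − τ)) ν` if `z θ = 0`. -/
def IsVickreyFlow (τ' ν' : ℝ) (fi fo : ℝ → ℝ) : Prop :=
  (∀ θ, 0 ≤ fi θ) ∧ (∀ θ, 0 ≤ fo θ) ∧
  (∃ M : ℝ, ∀ θ, fi θ ≤ M ∧ fo θ ≤ M) ∧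
  LocallyIntegrable fi ∧ LocallyIntegrable fo ∧
  (∀ θ < (0:ℝ), fi θ = 0) ∧ (∀ θ < (0:ℝ), fo θ = 0) ∧
  (∀ θ : ℝ, 0 ≤ cumul fi (θ - τ') - cumul fo θ) ∧
  (∀ᵐ θ : ℝ ∂volume,
    (0 < cumul fi (θ - τ') - cumul fo θ → fo θ = ν') ∧
    (cumul fi (θ - τ') - cumul fo θ = 0 → fo θ = min (fi (θ - τ')) ν'))

section StepFunction

lemma stepFun_nonneg {cnt : ℕ → ℕ} (hα : 0 < α) (hβ : 0 < β) (θ : ℝ) :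
    0 ≤ stepFun α β cnt θ := by
  unfold stepFun
  split_ifs <;> positivity

lemma measurable_stepFun (cnt : ℕ → ℕ) : Measurable (stepFun α β cnt) := by
  unfold stepFun
  refine Measurable.ite measurableSet_Ioi ?_ measurable_const
  have h : Measurable fun θ : ℝ => ⌈θ / α⌉₊ := Nat.measurable_ceil.comp (measurable_id.div_const α)
  exact ((measurable_from_top (f := fun k : ℕ => (cnt k : ℝ))).comp h).const_mul _

lemma intervalIntegrable_stepFun {cnt : ℕ → ℕ} {N : ℕ} (hα : 0 < α) (hβ : 0 < β)
    (hN : ∀ t, cnt t ≤ N) (a b : ℝ) : IntervalIntegrable (stepFun α β cnt) volume a b := by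
  refine (intervalIntegrable_const (c := β / α * (N : ℝ))).mono_fun
    (measurable_stepFun cnt).aestronglyMeasurable (Filter.Eventually.of_forall fun θ => ?_)
  beta_reduce
  rw [Real.norm_of_nonneg (stepFun_nonneg hα hβ θ), Real.norm_of_nonneg (by positivity)]
  unfold stepFun
  split_ifs
  · gcongr
    exact hN _
  · positivity

lemma monotone_cumul {f : ℝ → ℝ} (hf : ∀ θ, 0 ≤ f θ)
    (hi : ∀ a b, IntervalIntegrable f volume a b) : Monotone (cumul f) := by
  intro a b hab
  have h := intervalIntegral.integral_interval_sub_left (hi 0 b) (hi 0 a)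
  have := intervalIntegral.integral_nonneg hab (μ := volume) fun u _ => hf u
  unfold cumul
  linarith

lemma cumul_stepFun_mul {cnt : ℕ → ℕ} {N : ℕ} (hα : 0 < α) (hβ : 0 < β)
    (hN : ∀ t, cnt t ≤ N) (t : ℕ) :
    cumul (stepFun α β cnt) (t * α) = β * ∑ u ∈ range t, (cnt (u + 1) : ℝ) := by
  induction t with
  | zero => simp [cumul]
  | succ t ih =>
    have hi := intervalIntegrable_stepFun hα hβ hN
    have hle : (t : ℝ) * α ≤ ((t + 1 : ℕ) : ℝ) * α := by push_cast; nlinarith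
    have hpiece : ∫ ξ in (t * α : ℝ)..((t + 1 : ℕ) * α), stepFun α β cnt ξ
        = β * (cnt (t + 1) : ℝ) := by
      rw [intervalIntegral.integral_of_le hle,
        setIntegral_congr_fun (g := fun _ => β / α * (cnt (t + 1) : ℝ)) measurableSet_Ioc,
        setIntegral_const, Real.volume_real_Ioc_of_le hle]
      · push_cast
        simp only [smul_eq_mul]
        field_simp
        ring
      · intro ξ hξ
        have hpos : 0 < ξ := lt_of_le_of_lt (by positivity) hξ.1
        have hceil : ⌈ξ / α⌉₊ = t + 1 := by
          rw [Nat.ceil_eq_iff (by omega)]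
          exact ⟨by simpa using (lt_div_iff₀ hα).2 hξ.1, (div_le_iff₀ hα).2 hξ.2⟩
        simp [stepFun, hpos, hceil]
    have h := intervalIntegral.integral_add_adjacent_intervals (hi 0 (t * α))
      (hi (t * α) ((t + 1 : ℕ) * α))
    unfold cumul at ih ⊢
    rw [← h, ih, hpiece, sum_range_succ]
    ring

lemma sum_card_filter_eq {n : ℕ} (f : Fin n → ℕ) (p q : ℕ) :
    ∑ u ∈ Ico p q, (univ.filter fun i => f i = u).card
      = (univ.filter fun i => p ≤ f i ∧ f i < q).card := by
  rw [card_eq_sum_card_fiberwise (f := f) (t := Ico p q) (fun i hi => by simpa using hi)]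
  refine sum_congr rfl fun u hu => ?_
  congr 1
  ext i
  simp only [mem_Ico] at hu
  simp only [mem_filter, mem_univ, true_and]
  constructor
  · rintro rfl
    exact ⟨hu, rfl⟩
  · exact fun h => h.2

/-- The cumulative flow of packets with time steps `f` counts the packets up to a step. -/
lemma cumul_stepFun_card {n : ℕ} {f : Fin n → ℕ} (hα : 0 < α) (hβ : 0 < β)
    (hf : ∀ i, 1 ≤ f i) (t : ℕ) :
    cumul (stepFun α β fun u => (univ.filter fun i => f i = u).card) (t * α)
      = β * ((univ.filter fun i => f i ≤ t).card : ℝ) := by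
  rw [cumul_stepFun_mul (N := n) hα hβ (fun u => by
    simpa using card_le_univ (univ.filter fun i => f i = u)),
    ← Nat.cast_sum, range_eq_Ico,
    sum_Ico_add' (fun u => (univ.filter fun i => f i = u).card), sum_card_filter_eq]
  congr 3
  ext i
  simp [hf i]

lemma cumul_stepFun_of_nonpos {cnt : ℕ → ℕ} {θ : ℝ} (hθ : θ ≤ 0) :
    cumul (stepFun α β cnt) θ = 0 := by
  unfold cumul
  rw [intervalIntegral.integral_symm, intervalIntegral.integral_of_le hθ,
    setIntegral_congr_fun (g := fun _ => (0 : ℝ)) measurableSet_Ioc]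
  · simp
  · intro ξ hξ
    simp [stepFun, not_lt.2 hξ.2]

end StepFunction

section VickreyFlow

variable {fi fo : ℝ → ℝ}

lemma IsVickreyFlow.intervalIntegrable_out (h : IsVickreyFlow τ ν fi fo) (a b : ℝ) :
    IntervalIntegrable fo volume a b :=
  (h.2.2.2.2.1.integrableOn_isCompact isCompact_uIcc).intervalIntegrable

lemma IsVickreyFlow.intervalIntegrable_in (h : IsVickreyFlow τ ν fi fo) (a b : ℝ) :
    IntervalIntegrable fi volume a b :=
  (h.2.2.2.1.integrableOn_isCompact isCompact_uIcc).intervalIntegrable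

lemma IsVickreyFlow.monotone_out (h : IsVickreyFlow τ ν fi fo) : Monotone (cumul fo) :=
  monotone_cumul h.2.1 h.intervalIntegrable_out

/-- The outflow of a queue never exceeds the capacity. -/
lemma IsVickreyFlow.out_le (h : IsVickreyFlow τ ν fi fo) {s x : ℝ} (hsx : s ≤ x) :
    cumul fo x ≤ cumul fo s + ν * (x - s) := by
  have h1 := intervalIntegral.integral_interval_sub_left (h.intervalIntegrable_out 0 x)
    (h.intervalIntegrable_out 0 s)
  have h2 : ∫ ξ in s..x, fo ξ ≤ ∫ _ in s..x, ν := by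
    refine intervalIntegral.integral_mono_ae hsx (h.intervalIntegrable_out s x)
      intervalIntegrable_const ?_
    filter_upwards [h.2.2.2.2.2.2.2.2] with θ hθ
    rcases (h.2.2.2.2.2.2.2.1 θ).lt_or_eq with hz | hz
    · exact (hθ.1 hz).le
    · exact (hθ.2 hz.symm).le.trans (min_le_right _ _)
  rw [intervalIntegral.integral_const, smul_eq_mul] at h2
  unfold cumul
  linarith

/-- At any time there is an earlier moment with empty queue since which the arc has been
operating at full capacity. -/
lemma IsVickreyFlow.exists_last_empty (h : IsVickreyFlow τ ν fi fo)
    (h0 : cumul fi (-τ) = 0) {x : ℝ} (hx : 0 ≤ x) :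
    ∃ s, 0 ≤ s ∧ s ≤ x ∧ cumul fo x = cumul fi (s - τ) + ν * (x - s) := by
  have hco : Continuous (cumul fo) :=
    intervalIntegral.continuous_primitive h.intervalIntegrable_out 0
  have hci : Continuous (cumul fi) :=
    intervalIntegral.continuous_primitive h.intervalIntegrable_in 0
  have hz : Continuous fun s => cumul fi (s - τ) - cumul fo s := by fun_prop
  have hcomp : IsCompact (Set.Icc 0 x ∩ {s | cumul fi (s - τ) - cumul fo s = 0}) :=
    isCompact_Icc.inter_right (isClosed_eq hz continuous_const)
  have hne : (Set.Icc 0 x ∩ {s | cumul fi (s - τ) - cumul fo s = 0}).Nonempty :=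
    ⟨0, ⟨le_rfl, hx⟩, by simp [h0]; simp [cumul]⟩
  obtain ⟨s, ⟨hs, hs0⟩, hmax⟩ := hcomp.exists_isGreatest hne
  refine ⟨s, hs.1, hs.2, ?_⟩
  have h1 := intervalIntegral.integral_interval_sub_left (h.intervalIntegrable_out 0 x)
    (h.intervalIntegrable_out 0 s)
  have h2 : ∫ ξ in s..x, fo ξ = ∫ _ in s..x, ν := by
    refine intervalIntegral.integral_congr_ae ?_
    filter_upwards [h.2.2.2.2.2.2.2.2] with θ hθ hmem
    rw [Set.uIoc_of_le hs.2] at hmem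
    refine hθ.1 ((h.2.2.2.2.2.2.2.1 θ).lt_of_ne fun hzero => ?_)
    exact absurd (hmax ⟨⟨hs.1.trans hmem.1.le, hmem.2⟩, hzero.symm⟩) (not_le.2 hmem.1)
  rw [intervalIntegral.integral_const, smul_eq_mul] at h2
  simp only [Set.mem_ofPred_eq] at hs0
  unfold cumul at hs0 ⊢
  linarith

end VickreyFlow

section Routing

variable (R : PacketRouting J τ ν κ α β)

lemma PacketRouting.one_le_leaveStep (i : Fin R.n) : 1 ≤ R.leaveStep i :=
  (R.entPos i).trans ((Nat.le_add_right _ _).trans (R.leaveGe i))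

/-- Packets leave the arc in FIFO order. -/
lemma PacketRouting.monotone_leaveStep : Monotone R.leaveStep := by
  intro i j hij
  by_contra! hlt
  have hj : j ∈ buffer R.entStep R.leaveStep ⌈τ / α⌉₊ (R.leaveStep j) := by
    simpa [buffer] using R.leaveGe j
  have hi : i ∈ buffer R.entStep R.leaveStep ⌈τ / α⌉₊ (R.leaveStep j) := by
    simpa [buffer] using
      ⟨(Nat.add_le_add_right (R.entMono hij) _).trans (R.leaveGe j), hlt.le⟩
  have hspec := (R.leaveSpec _ (R.one_le_leaveStep j) j hj).1 rfl
  refine hlt.ne' ((R.leaveSpec _ (R.one_le_leaveStep j) i hi).2 (lt_of_le_of_lt ?_ hspec))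
  exact_mod_cast card_le_card
    (monotone_filter_right _ fun a _ (ha : a < i) => ha.trans_le hij)

lemma PacketRouting.filter_leaveStep_subset_buffer (t : ℕ) :
    univ.filter (fun i => R.leaveStep i = t) ⊆
      buffer R.entStep R.leaveStep ⌈τ / α⌉₊ t := by
  intro i hi
  obtain rfl : R.leaveStep i = t := by simpa using hi
  simpa [buffer] using R.leaveGe i

lemma PacketRouting.le_cap {t : ℕ} (ht : 1 ≤ t) : ν * α / β ≤ R.cap t := by
  induction t, ht using Nat.le_induction with
  | base => exact R.cap1.ge
  | succ t ht ih =>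
    rw [R.capRec t ht]
    split_ifs
    · exact le_rfl
    · linarith [Int.floor_le (R.cap t)]

lemma PacketRouting.cap_le {t : ℕ} (ht : 1 ≤ t) : R.cap t ≤ ν * α / β + 1 := by
  induction t, ht using Nat.le_induction with
  | base => rw [R.cap1]; linarith
  | succ t ht ih =>
    rw [R.capRec t ht]
    split_ifs
    · linarith
    · linarith [Int.lt_floor_add_one (R.cap t)]

lemma PacketRouting.lvCountTot_le_floor (hnu : 0 ≤ ν * α / β) {t : ℕ} (ht : 1 ≤ t) :
    (lvCountTot R t : ℤ) ≤ ⌊R.cap t⌋ := by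
  unfold lvCountTot
  rcases (univ.filter fun i => R.leaveStep i = t).eq_empty_or_nonempty with he | hne
  · rw [he]
    simpa using Int.floor_nonneg.2 (hnu.trans (R.le_cap ht))
  · obtain ⟨j, hj, hmax⟩ := exists_max_image _ id hne
    have hsub := R.filter_leaveStep_subset_buffer t
    have hspec := (R.leaveSpec t ht j (hsub hj)).1 (by simpa using hj)
    have hle : (univ.filter fun i => R.leaveStep i = t) ⊆ insert j
        ((buffer R.entStep R.leaveStep ⌈τ / α⌉₊ t).filter fun i' => i' < j) := by
      intro i hi
      rcases (hmax i hi).lt_or_eq with hlt | heq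
      · exact mem_insert_of_mem (mem_filter.2 ⟨hsub hi, hlt⟩)
      · exact mem_insert.2 (Or.inl heq)
    have hcard := (card_le_card hle).trans (card_insert_le _ _)
    have := hspec.trans_le (min_le_right _ _)
    omega

/-- If the buffer does not exceed the capacity, it is emptied. -/
lemma PacketRouting.leaveStep_le_of_card_le {t : ℕ} (ht : 1 ≤ t)
    (hB : ((buffer R.entStep R.leaveStep ⌈τ / α⌉₊ t).card : ℝ) ≤ R.cap t)
    {i : Fin R.n} (hi : R.entStep i + ⌈τ / α⌉₊ ≤ t) : R.leaveStep i ≤ t := by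
  by_contra! hlt
  have hmem : i ∈ buffer R.entStep R.leaveStep ⌈τ / α⌉₊ t := by
    simpa [buffer] using ⟨hi, hlt.le⟩
  have hfl : ((buffer R.entStep R.leaveStep ⌈τ / α⌉₊ t).card : ℤ) ≤ ⌊R.cap t⌋ :=
    Int.le_floor.2 (by exact_mod_cast hB)
  refine hlt.ne' ((R.leaveSpec t ht i hmem).2 ?_)
  rw [min_eq_left hfl]
  have hlt' : ((buffer R.entStep R.leaveStep ⌈τ / α⌉₊ t).filter fun i' => i' < i).card
      < (buffer R.entStep R.leaveStep ⌈τ / α⌉₊ t).card :=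
    card_lt_card (filter_ssubset.2 ⟨i, hmem, lt_irrefl i⟩)
  exact_mod_cast hlt'

/-- If the buffer exceeds the capacity, the capacity is fully used. -/
lemma PacketRouting.floor_le_lvCountTot {t : ℕ} (ht : 1 ≤ t)
    (hB : R.cap t < ((buffer R.entStep R.leaveStep ⌈τ / α⌉₊ t).card : ℝ)) :
    ⌊R.cap t⌋ ≤ (lvCountTot R t : ℤ) := by
  unfold lvCountTot
  by_contra! hlt
  have hfl : ⌊R.cap t⌋ ≤ ((buffer R.entStep R.leaveStep ⌈τ / α⌉₊ t).card : ℤ) := by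
    exact_mod_cast (Int.floor_le (R.cap t)).trans hB.le
  have hne : (buffer R.entStep R.leaveStep ⌈τ / α⌉₊ t \
      univ.filter fun i => R.leaveStep i = t).Nonempty := by
    rw [sdiff_nonempty]
    intro hsub
    have := card_le_card hsub
    omega
  obtain ⟨i, hi, hmin⟩ := exists_min_image _ id hne
  obtain ⟨hiB, hiL⟩ := mem_sdiff.1 hi
  refine hiL (mem_filter.2 ⟨mem_univ _, (R.leaveSpec t ht i hiB).2 ?_⟩)
  rw [min_eq_right hfl]
  refine lt_of_le_of_lt ?_ hlt
  have hsub : ((buffer R.entStep R.leaveStep ⌈τ / α⌉₊ t).filter fun i' => i' < i) ⊆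
      univ.filter fun i => R.leaveStep i = t := by
    intro j hj
    obtain ⟨hjB, hji⟩ := mem_filter.1 hj
    by_contra hjL
    exact absurd (hmin j (mem_sdiff.2 ⟨hjB, hjL⟩)) (not_le.2 hji)
  exact_mod_cast card_le_card hsub

lemma PacketRouting.sum_floor_cap_le {p q : ℕ} (hp : 1 ≤ p) (hpq : p ≤ q) :
    ∑ u ∈ Ico p q, (⌊R.cap u⌋ : ℝ) ≤ ((q : ℝ) - p) * (ν * α / β) + R.cap p - R.cap q := by
  induction q, hpq using Nat.le_induction with
  | base => simp
  | succ q hpq ih =>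
    have hcap : R.cap (q + 1) ≤ ν * α / β + R.cap q - ⌊R.cap q⌋ := by
      rw [R.capRec q (hp.trans hpq)]
      split_ifs
      · linarith [Int.floor_le (R.cap q)]
      · exact le_rfl
    rw [sum_Ico_succ_top hpq]
    push_cast
    linarith

lemma PacketRouting.le_sum_lvCountTot {p q : ℕ} (hp : 1 ≤ p) (hpq : p ≤ q)
    (hB : ∀ u, p ≤ u → u < q →
      R.cap u < ((buffer R.entStep R.leaveStep ⌈τ / α⌉₊ u).card : ℝ)) :
    ((q : ℝ) - p) * (ν * α / β) + R.cap p - R.cap q ≤ ∑ u ∈ Ico p q, (lvCountTot R u : ℝ) := by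
  induction q, hpq using Nat.le_induction with
  | base => simp
  | succ q hpq ih =>
    have hq := hB q hpq q.lt_succ_self
    have hcap : R.cap (q + 1) = ν * α / β + R.cap q - ⌊R.cap q⌋ := by
      rw [R.capRec q (hp.trans hpq), if_neg (not_le.2 hq)]
    have hfl : (⌊R.cap q⌋ : ℝ) ≤ (lvCountTot R q : ℝ) := by
      exact_mod_cast R.floor_le_lvCountTot (hp.trans hpq) hq
    have := ih fun u hu huq => hB u hu (huq.trans q.lt_succ_self)
    rw [sum_Ico_succ_top hpq]
    push_cast
    linarith

/-- A packet needs at least as long as the packets from `i` on need to pass the arc. -/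
lemma PacketRouting.sub_le_leaveStep (hnu : 0 ≤ ν * α / β) {i j : Fin R.n} (hij : i ≤ j) :
    (j : ℝ) - i ≤ ((R.leaveStep j : ℝ) + 1 - (R.entStep i + ⌈τ / α⌉₊ : ℕ)) * (ν * α / β) := by
  set p := R.entStep i + ⌈τ / α⌉₊ with hp
  have hp1 : 1 ≤ p := (R.entPos i).trans (Nat.le_add_right _ _)
  have hpL : p ≤ R.leaveStep j := (R.leaveGe i).trans (R.monotone_leaveStep hij)
  have hsub : Icc i j ⊆ univ.filter fun l => p ≤ R.leaveStep l ∧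
      R.leaveStep l < R.leaveStep j + 1 := by
    intro l hl
    obtain ⟨hil, hlj⟩ := mem_Icc.1 hl
    simpa [Nat.lt_succ_iff] using
      ⟨(R.leaveGe i).trans (R.monotone_leaveStep hil), R.monotone_leaveStep hlj⟩
  have hcard := card_le_card hsub
  rw [← sum_card_filter_eq, Fin.card_Icc] at hcard
  change _ ≤ ∑ u ∈ Ico p (R.leaveStep j + 1), lvCountTot R u at hcard
  have hij' : (i : ℕ) ≤ j := hij
  have h1 : (j : ℝ) + 1 - i ≤ ∑ u ∈ Ico p (R.leaveStep j + 1), (lvCountTot R u : ℝ) := by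
    have : (j : ℕ) + 1 ≤ ∑ u ∈ Ico p (R.leaveStep j + 1), lvCountTot R u + i := by omega
    have : (j : ℝ) + 1 ≤ ∑ u ∈ Ico p (R.leaveStep j + 1), (lvCountTot R u : ℝ) + i := by
      exact_mod_cast this
    linarith
  have h2 : ∑ u ∈ Ico p (R.leaveStep j + 1), (lvCountTot R u : ℝ)
      ≤ ∑ u ∈ Ico p (R.leaveStep j + 1), (⌊R.cap u⌋ : ℝ) :=
    sum_le_sum fun u hu => by
      exact_mod_cast R.lvCountTot_le_floor hnu (hp1.trans (mem_Ico.1 hu).1)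
  have h3 := R.sum_floor_cap_le hp1 (hpL.trans (Nat.le_succ _))
  have h4 := R.cap_le hp1
  have h5 := R.le_cap (t := R.leaveStep j + 1) (by omega)
  push_cast at h3
  linarith

/-- The leaving step of a packet is dominated by the first packet of its busy period. -/
lemma PacketRouting.exists_leaveStep_le (hnu : 0 ≤ ν * α / β) (j : Fin R.n) :
    ∃ i ≤ j, ((R.leaveStep j : ℝ) - (R.entStep i + ⌈τ / α⌉₊ : ℕ)) * (ν * α / β)
      ≤ (j : ℝ) - i + 1 := by
  classical
  set L := R.leaveStep j with hL
  have hL1 : 1 ≤ L := R.one_le_leaveStep j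
  let P : ℕ → Prop := fun p =>
    p = 0 ∨ ((buffer R.entStep R.leaveStep ⌈τ / α⌉₊ p).card : ℝ) ≤ R.cap p
  set p := Nat.findGreatest P (L - 1) with hp
  have hPp : P p := Nat.findGreatest_spec (Nat.zero_le _) (Or.inl rfl)
  have hpL : p ≤ L - 1 := Nat.findGreatest_le _
  have hbusy : ∀ u, p + 1 ≤ u → u < L →
      R.cap u < ((buffer R.entStep R.leaveStep ⌈τ / α⌉₊ u).card : ℝ) := by
    intro u hu huL
    have := Nat.findGreatest_is_greatest (P := P) (n := L - 1) (k := u) (by omega) (by omega)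
    simp only [P, not_or, not_le] at this
    exact this.2
  have hcapp : R.cap (p + 1) = ν * α / β := by
    rcases Nat.eq_zero_or_pos p with h0 | hpos
    · rw [h0]; exact R.cap1
    · rw [R.capRec p hpos, if_pos (hPp.resolve_left hpos.ne')]
  have hclear : ∀ i, R.entStep i + ⌈τ / α⌉₊ ≤ p → R.leaveStep i ≤ p := by
    intro i hi
    have hpos : 1 ≤ p := (R.entPos i).trans ((Nat.le_add_right _ _).trans hi)
    exact R.leaveStep_le_of_card_le hpos (hPp.resolve_left (by omega)) hi
  have hsum := R.le_sum_lvCountTot (p := p + 1) (q := L) (by omega) (by omega) hbusy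
  set a := (univ.filter fun i => R.leaveStep i ≤ p).card with ha
  have htotal : a + ∑ u ∈ Ico (p + 1) L, lvCountTot R u ≤ j := by
    unfold lvCountTot
    rw [sum_card_filter_eq, ha, ← card_union_of_disjoint]
    · rw [← Fin.card_Iio j]
      refine card_le_card fun i hi => ?_
      have hlt : R.leaveStep i < L := by
        simp only [mem_union, mem_filter, mem_univ, true_and] at hi
        omega
      exact mem_Iio.2 (R.monotone_leaveStep.reflect_lt hlt)
    · rw [disjoint_filter]
      intro i _ h1 h2
      omega
  have haj : a ≤ j := by omega
  refine ⟨⟨a, haj.trans_lt j.2⟩, haj, ?_⟩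
  have hent : p + 1 ≤ R.entStep ⟨a, haj.trans_lt j.2⟩ + ⌈τ / α⌉₊ := by
    by_contra! hlt
    have hle := hclear _ (Nat.lt_succ_iff.1 hlt)
    have hsub : Iic (⟨a, haj.trans_lt j.2⟩ : Fin R.n) ⊆
        univ.filter fun i => R.leaveStep i ≤ p := fun i hi =>
      mem_filter.2 ⟨mem_univ _, (R.monotone_leaveStep (mem_Iic.1 hi)).trans hle⟩
    have := card_le_card hsub
    rw [Fin.card_Iic, ← ha] at this
    simp at this
  have hcapL := R.cap_le hL1
  have htotal' : (a : ℝ) + ∑ u ∈ Ico (p + 1) L, (lvCountTot R u : ℝ) ≤ (j : ℕ) := by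
    exact_mod_cast htotal
  have hent' : ((p + 1 : ℕ) : ℝ) ≤ (R.entStep ⟨a, haj.trans_lt j.2⟩ + ⌈τ / α⌉₊ : ℕ) :=
    Nat.cast_le.2 hent
  have hmul := mul_le_mul_of_nonneg_right hent' hnu
  simp only [sub_mul] at hsum ⊢
  linarith

/-- Lower bound on the hypothetical departure time in terms of an earlier packet. -/
lemma PacketRouting.entStep_le_of_le_out {hout : ℝ → ℝ} (hα : 0 < α) (hβ : 0 < β)
    (hV : IsVickreyFlow τ ν (stepFun α β (entCountTot R)) hout) {φ x : ℝ}
    (hx : φ ≤ cumul hout x) {i : Fin R.n} (hi : (i : ℝ) * β < φ) :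
    ν * (((R.entStep i : ℝ) - 1) * α + τ) + (φ - i * β) ≤ ν * x := by
  obtain ⟨e, he⟩ : ∃ e, R.entStep i = e + 1 := Nat.exists_eq_add_of_le' (R.entPos i)
  have hz := hV.2.2.2.2.2.2.2.1 (e * α + τ)
  rw [add_sub_cancel_right] at hz
  have hG : cumul (stepFun α β (entCountTot R)) (e * α)
      = β * ((univ.filter fun l => R.entStep l ≤ e).card : ℝ) :=
    cumul_stepFun_card hα hβ R.entPos e
  have hcard : (univ.filter fun l => R.entStep l ≤ e).card ≤ i := by
    rw [← Fin.card_Iio i]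
    refine card_le_card fun l hl => mem_Iio.2 (R.entMono.reflect_lt ?_)
    have : R.entStep l ≤ e := by simpa using hl
    omega
  have hcard' : ((univ.filter fun l => R.entStep l ≤ e).card : ℝ) ≤ i := Nat.cast_le.2 hcard
  have hle : cumul hout (e * α + τ) ≤ i * β := by
    have := mul_le_mul_of_nonneg_left hcard' hβ.le
    linarith
  have hsx : e * α + τ ≤ x := by
    by_contra! hlt
    linarith [hV.monotone_out hlt.le]
  have := hV.out_le hsx
  rw [he]
  push_cast
  rw [add_sub_cancel_right]
  linarith

/-- Upper bound on times before the hypothetical departure in terms of an earlier packet. -/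
lemma PacketRouting.exists_le_of_out_lt {hout : ℝ → ℝ} (hν : 0 < ν) (hτ : 0 < τ) (hα : 0 < α)
    (hβ : 0 < β) (hV : IsVickreyFlow τ ν (stepFun α β (entCountTot R)) hout) {φ x : ℝ}
    (hφ : φ ≤ β * R.n) (hx0 : 0 ≤ x) (hx : cumul hout x < φ) :
    ∃ i : Fin R.n, (i : ℝ) * β < φ ∧
      ν * x ≤ ν * (R.entStep i * α + τ) + (φ - i * β) := by
  obtain ⟨s, hs0, hsx, hs⟩ :=
    hV.exists_last_empty (cumul_stepFun_of_nonpos (by linarith)) hx0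
  set e := ⌊(s - τ) / α⌋₊ with he
  set a := (univ.filter fun l => R.entStep l ≤ e).card with ha
  have hG : cumul (stepFun α β (entCountTot R)) (e * α) = β * (a : ℝ) :=
    cumul_stepFun_card hα hβ R.entPos e
  have hmono : Monotone (cumul (stepFun α β (entCountTot R))) :=
    monotone_cumul hV.1 hV.intervalIntegrable_in
  have hGs : a * β ≤ cumul (stepFun α β (entCountTot R)) (s - τ) := by
    rcases le_or_gt 0 (s - τ) with h0 | h0
    · have := hmono ((le_div_iff₀ hα).1 (Nat.floor_le (div_nonneg h0 hα.le)))
      rw [← he, hG] at this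
      linarith
    · have he0 : e = 0 := Nat.floor_of_nonpos (div_nonpos_of_nonpos_of_nonneg h0.le hα.le)
      rw [cumul_stepFun_of_nonpos h0.le, mul_comm, ← hG, he0]
      simp [cumul]
  have hνx : 0 ≤ ν * (x - s) := mul_nonneg hν.le (by linarith)
  have haφ : a * β < φ := by linarith
  have han : a < R.n := by
    have : (a : ℝ) < R.n := lt_of_mul_lt_mul_right (by linarith) hβ.le
    exact_mod_cast this
  refine ⟨⟨a, han⟩, haφ, ?_⟩
  have hent : e + 1 ≤ R.entStep ⟨a, han⟩ := by
    by_contra! hlt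
    have hsub : Iic (⟨a, han⟩ : Fin R.n) ⊆ univ.filter fun l => R.entStep l ≤ e := fun l hl =>
      mem_filter.2 ⟨mem_univ _, (R.entMono (mem_Iic.1 hl)).trans (Nat.lt_succ_iff.1 hlt)⟩
    have := card_le_card hsub
    rw [Fin.card_Iic, ← ha] at this
    simp at this
  have hent' : (e : ℝ) + 1 ≤ R.entStep ⟨a, han⟩ := by exact_mod_cast hent
  have hsle : s ≤ R.entStep ⟨a, han⟩ * α + τ := by
    have := (div_lt_iff₀ hα).1 (Nat.lt_floor_add_one ((s - τ) / α))
    have := mul_le_mul_of_nonneg_right hent' hα.le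
    linarith
  have := mul_le_mul_of_nonneg_left hsle hν.le
  simp only
  linarith

/-- The refined departure time of a packet lies in the step in which the packet leaves. -/
lemma PacketRouting.sInf_Gout_mem (hα : 0 < α) (hβ : 0 < β) (j : Fin R.n) :
    ((R.leaveStep j : ℝ) - 1) * α ≤ sInf {x : ℝ | 0 ≤ x ∧ ((j : ℝ) + 1) * β ≤ Gout R x} ∧
      sInf {x : ℝ | 0 ≤ x ∧ ((j : ℝ) + 1) * β ≤ Gout R x} ≤ R.leaveStep j * α := by
  have hG : ∀ t : ℕ, Gout R (t * α) = β * ((univ.filter fun l => R.leaveStep l ≤ t).card : ℝ) :=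
    cumul_stepFun_card hα hβ R.one_le_leaveStep
  have hmono : Monotone (Gout R) :=
    monotone_cumul (stepFun_nonneg hα hβ) (intervalIntegrable_stepFun (N := R.n) hα hβ
      fun u => by
        simpa [lvCountTot] using card_le_univ (univ.filter fun i => R.leaveStep i = u))
  have hmem : (R.leaveStep j : ℝ) * α ∈ {x : ℝ | 0 ≤ x ∧ ((j : ℝ) + 1) * β ≤ Gout R x} := by
    refine ⟨by positivity, ?_⟩
    have hsub : Iic j ⊆ univ.filter fun l => R.leaveStep l ≤ R.leaveStep j := fun l hl =>
      mem_filter.2 ⟨mem_univ _, R.monotone_leaveStep (mem_Iic.1 hl)⟩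
    have hcard := card_le_card hsub
    rw [Fin.card_Iic] at hcard
    have hcard' : (j : ℝ) + 1 ≤
        ((univ.filter fun l => R.leaveStep l ≤ R.leaveStep j).card : ℝ) := by
      exact_mod_cast hcard
    rw [hG, mul_comm β]
    exact mul_le_mul_of_nonneg_right hcard' hβ.le
  refine ⟨le_csInf ⟨_, hmem⟩ fun x hx => ?_, csInf_le ⟨0, fun x hx => hx.1⟩ hmem⟩
  by_contra! hlt
  obtain ⟨e, he⟩ : ∃ e, R.leaveStep j = e + 1 :=
    Nat.exists_eq_add_of_le' (R.one_le_leaveStep j)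
  rw [he] at hlt
  push_cast at hlt
  rw [add_sub_cancel_right] at hlt
  have hcard : (univ.filter fun l => R.leaveStep l ≤ e).card ≤ j := by
    rw [← Fin.card_Iio j]
    refine card_le_card fun l hl => mem_Iio.2 (R.monotone_leaveStep.reflect_lt ?_)
    have : R.leaveStep l ≤ e := by simpa using hl
    omega
  have hcard' : ((univ.filter fun l => R.leaveStep l ≤ e).card : ℝ) ≤ j := Nat.cast_le.2 hcard
  have h1 := (hx.2.trans (hmono hlt.le)).trans_eq (hG e)
  have h2 := mul_le_mul_of_nonneg_left hcard' hβ.le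
  linarith

/-- The hypothetical departure time of a particle is within `α + β / ν` above and
`2 * α + β / ν` below the end of the leaving step of its packet. -/
lemma PacketRouting.sInf_out_mem {hout : ℝ → ℝ} (hν : 0 < ν) (hτ : 0 < τ) (hα : 0 < α)
    (hβ : 0 < β) (hV : IsVickreyFlow τ ν (stepFun α β (entCountTot R)) hout) {φ : ℝ}
    {j : Fin R.n} (hjφ : (j : ℝ) * β < φ) (hφj : φ ≤ ((j : ℝ) + 1) * β) :
    R.leaveStep j * α - 2 * α - β / ν ≤ sInf {x : ℝ | 0 ≤ x ∧ φ ≤ cumul hout x} ∧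
      sInf {x : ℝ | 0 ≤ x ∧ φ ≤ cumul hout x} ≤ R.leaveStep j * α + α + β / ν := by
  have hnu : 0 ≤ ν * α / β := by positivity
  have hτα : τ ≤ ⌈τ / α⌉₊ * α := (div_le_iff₀ hα).1 (Nat.le_ceil _)
  have hατ : ⌈τ / α⌉₊ * α ≤ τ + α := by
    have := mul_le_mul_of_nonneg_right (Nat.ceil_lt_add_one (div_pos hτ hα).le).le hα.le
    rwa [add_mul, div_mul_cancel₀ _ hα.ne', one_mul] at this
  have hscale : ∀ y : ℝ, y * (ν * α / β) * β = y * ν * α := fun y => by field_simp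
  have hφn : φ ≤ β * R.n := by
    have hjn : (j : ℝ) + 1 ≤ R.n := by exact_mod_cast j.2
    have := mul_le_mul_of_nonneg_right hjn hβ.le
    linarith
  have hβν : ν * (β / ν) = β := mul_div_cancel₀ _ hν.ne'
  have hupper : ∀ x, R.leaveStep j * α + α + β / ν < x →
      x ∈ {x : ℝ | 0 ≤ x ∧ φ ≤ cumul hout x} := by
    intro x hx
    have hx0 : 0 ≤ x := le_trans (by positivity) hx.le
    refine ⟨hx0, ?_⟩
    by_contra! hlt
    obtain ⟨i, hi, hle⟩ := R.exists_le_of_out_lt hν hτ hα hβ hV hφn hx0 hlt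
    have hij : i ≤ j := by
      have : (i : ℝ) < (j : ℝ) + 1 := lt_of_mul_lt_mul_right (hi.trans_le hφj) hβ.le
      exact Nat.lt_succ_iff.1 (by exact_mod_cast this)
    have h1 := mul_le_mul_of_nonneg_right (R.sub_le_leaveStep hnu hij) hβ.le
    rw [hscale] at h1
    push_cast at h1
    have h2 := mul_le_mul_of_nonneg_left hτα hν.le
    have h3 := mul_lt_mul_of_pos_left hx hν
    linarith
  constructor
  · refine le_csInf ⟨_, hupper _ (lt_add_one _)⟩ fun x hx => ?_
    obtain ⟨i, hij, hle⟩ := R.exists_leaveStep_le hnu j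
    have hij' : (i : ℝ) ≤ j := by exact_mod_cast hij
    have hi := (mul_le_mul_of_nonneg_right hij' hβ.le).trans_lt hjφ
    have h0 := R.entStep_le_of_le_out hα hβ hV hx.2 hi
    have h1 := mul_le_mul_of_nonneg_right hle hβ.le
    rw [hscale] at h1
    push_cast at h1
    have h2 := mul_le_mul_of_nonneg_left hατ hν.le
    refine le_of_mul_le_mul_left ?_ hν
    linarith
  · exact le_of_forall_gt_imp_ge_of_dense fun x hx =>
      csInf_le ⟨0, fun y hy => hy.1⟩ (hupper x hx)

end Routing

/-- **Claim in the proof of Lemma 5.4.** There are constants `C̃₁, C̃₂ > 0` and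
thresholds `α₀, r₀ ∈ (0,1]`, depending only on `κ` and `ν`, such that for every
single-commodity single-arc packet routing with `0 < α ≤ α₀`, `0 < β ≤ r₀·α` and an
associated hypothetical flow over time `hout` (i.e. `(g⁺, hout)` is a Vickrey queue
flow), and every particle `φ ∈ (0, m]` with `m = β·n`, the hypothetical departure time
`inf{θ ≥ 0 : H⁻(θ) ≥ φ}` and the refined departure time `ℓ^D_v(⌈φ/β⌉)` of the
corresponding packet differ by at most `C̃₁·√α + φ·C̃₂·√α`. -/
theorem hypothetical_vs_discrete_departure (ν κ : ℝ) (hν : 0 < ν) (hκ : ν + 1 ≤ κ) :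
    ∃ C₁ C₂ α₀ r₀ : ℝ, 0 < C₁ ∧ 0 < C₂ ∧ (0 < α₀ ∧ α₀ ≤ 1) ∧ (0 < r₀ ∧ r₀ ≤ 1) ∧
      ∀ (τ α β : ℝ), 0 < τ → 0 < α → α ≤ α₀ → 0 < β → β ≤ r₀ * α →
      ∀ (R : PacketRouting Unit τ ν κ α β) (hout : ℝ → ℝ),
        IsVickreyFlow τ ν (stepFun α β (entCountTot R)) hout →
        ∀ φ : ℝ, 0 < φ → φ ≤ β * (R.n : ℝ) →
          |sInf {x : ℝ | 0 ≤ x ∧ φ ≤ cumul hout x} -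
              sInf {x : ℝ | 0 ≤ x ∧ (⌈φ / β⌉₊ : ℝ) * β ≤ Gout R x}| ≤
            C₁ * Real.sqrt α + φ * (C₂ * Real.sqrt α) := by
  refine ⟨2 + 1 / ν, 1, 1, 1, by positivity, one_pos, ⟨one_pos, le_rfl⟩, ⟨one_pos, le_rfl⟩, ?_⟩
  intro τ α β hτ hα hα1 hβ hβα R hout hV φ hφ hφn
  obtain ⟨k, hk⟩ : ∃ k, ⌈φ / β⌉₊ = k + 1 :=
    Nat.exists_eq_add_of_le' (Nat.ceil_pos.2 (div_pos hφ hβ))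
  obtain ⟨hkφ, hφk⟩ := (Nat.ceil_eq_iff (Nat.succ_ne_zero k)).1 hk
  rw [Nat.succ_sub_one, lt_div_iff₀ hβ] at hkφ
  rw [div_le_iff₀ hβ] at hφk
  push_cast at hφk
  have hkn : k < R.n := by
    have : (k : ℝ) < R.n := lt_of_mul_lt_mul_right (by linarith) hβ.le
    exact_mod_cast this
  obtain ⟨hS₁, hS₂⟩ := R.sInf_Gout_mem hα hβ ⟨k, hkn⟩
  obtain ⟨hT₁, hT₂⟩ := R.sInf_out_mem hν hτ hα hβ hV (j := ⟨k, hkn⟩) hkφ hφk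
  have hβν : β / ν ≤ 1 / ν * α := by
    rw [div_eq_mul_one_div, mul_comm]
    gcongr
    linarith
  have hsqrt : α ≤ Real.sqrt α := Real.le_sqrt_of_sq_le (by nlinarith)
  have hC : (2 + 1 / ν) * α ≤ (2 + 1 / ν) * Real.sqrt α := by gcongr
  have hφC : 0 ≤ φ * (1 * Real.sqrt α) := by positivity
  rw [hk]
  push_cast
  rw [abs_le]
  constructor <;> linarith
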